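/- Let d_A, d_B, d_E be positive natural numbers, V an isometry from ℂ^{d_A} to ℂ^{d_B} ⊗ ℂ^{d_E} with associated channel Φ(ρ) = Tr_E(V ρ Vᴴ), H_A a positive semidefinite Hermitian d_A×d_A matrix, and 𝓔 a real number such that some state ρ₀ on ℂ^{d_A} satisfies Re(Tr(H_A ρ₀)) ≤ 𝓔. Then there exists a Borel probability measure μ* on the set S_{d_A} of states, supported by pure states (μ* assigns measure 1 to the set of rank-one projections), such that Re(Tr(H_A ρ̄(μ*))) ≤ 𝓔 and χ(Φ(μ*)) = sup { χ(Φ(μ)) : μ a Borel probability measure on S_{d_A} with Re(Tr(H_A ρ̄(μ))) ≤ 𝓔 }, where ρ̄(μ) = ∫ ρ μ(dρ) and χ(Φ(μ)) = H(Φ(ρ̄(μ))) − ∫ H(Φ(ρ)) μ(dρ). -/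

import Mathlib

open MeasureTheory ComplexOrder Matrix

noncomputable section

instance matMS {m n : Type*} : MeasurableSpace (Matrix m n ℂ) :=
  inferInstanceAs (MeasurableSpace (m → n → ℂ))

instance matBS {m n : Type*} [Countable m] [Countable n] : BorelSpace (Matrix m n ℂ) :=
  inferInstanceAs (BorelSpace (m → n → ℂ))

/-- The set of quantum states (density matrices). -/
def stateSet (n : ℕ) : Set (Matrix (Fin n) (Fin n) ℂ) :=
  {ρ | ρ.PosSemidef ∧ ρ.trace = 1}

/-- Von Neumann entropy: sum of `negMulLog` over eigenvalues. -/
def vnEntropy {ι : Type*} [Fintype ι] [DecidableEq ι] (ρ : Matrix ι ι ℂ) : ℝ :=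
  if h : ρ.IsHermitian then ∑ i, Real.negMulLog (h.eigenvalues i) else 0

/-- Partial trace over the second (environment) factor. -/
def ptraceE {dB dE : ℕ} (M : Matrix (Fin dB × Fin dE) (Fin dB × Fin dE) ℂ) :
    Matrix (Fin dB) (Fin dB) ℂ :=
  Matrix.of fun b b' => ∑ e, M (b, e) (b', e)

/-- Partial trace over the first factor. -/
def ptraceB {dB dE : ℕ} (M : Matrix (Fin dB × Fin dE) (Fin dB × Fin dE) ℂ) :
    Matrix (Fin dE) (Fin dE) ℂ :=
  Matrix.of fun e e' => ∑ b, M (b, e) (b, e')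

/-- Quantum mutual information I(B:E) of a bipartite state. -/
def qmi {dB dE : ℕ} (ω : Matrix (Fin dB × Fin dE) (Fin dB × Fin dE) ℂ) : ℝ :=
  vnEntropy (ptraceE ω) + vnEntropy (ptraceB ω) - vnEntropy ω

/-- The channel `ρ ↦ Tr_E (V ρ V†)` associated with a Stinespring isometry `V`. -/
def chanPhi {dA dB dE : ℕ} (V : Matrix (Fin dB × Fin dE) (Fin dA) ℂ)
    (ρ : Matrix (Fin dA) (Fin dA) ℂ) : Matrix (Fin dB) (Fin dB) ℂ :=
  ptraceE (V * ρ * Vᴴ)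

/-- The complementary channel `ρ ↦ Tr_B (V ρ V†)`. -/
def chanPhiHat {dA dB dE : ℕ} (V : Matrix (Fin dB × Fin dE) (Fin dA) ℂ)
    (ρ : Matrix (Fin dA) (Fin dA) ℂ) : Matrix (Fin dE) (Fin dE) ℂ :=
  ptraceB (V * ρ * Vᴴ)

/-- Barycenter (average state) of a generalized ensemble. -/
def barycenter {n : ℕ} (μ : ProbabilityMeasure (stateSet n)) :
    Matrix (Fin n) (Fin n) ℂ :=
  Matrix.of fun i j => ∫ ρ : stateSet n, ρ.1 i j ∂(μ : Measure (stateSet n))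

/-- Output χ-quantity of a generalized ensemble under a map `Φ`. -/
def gChiOut {n d : ℕ} (Φ : Matrix (Fin n) (Fin n) ℂ → Matrix (Fin d) (Fin d) ℂ)
    (μ : ProbabilityMeasure (stateSet n)) : ℝ :=
  vnEntropy (Φ (barycenter μ)) -
    ∫ ρ : stateSet n, vnEntropy (Φ ρ.1) ∂(μ : Measure (stateSet n))

/-- χ-quantity of a generalized ensemble. -/
def gChi {n : ℕ} (μ : ProbabilityMeasure (stateSet n)) : ℝ :=
  vnEntropy (barycenter μ) -
    ∫ ρ : stateSet n, vnEntropy ρ.1 ∂(μ : Measure (stateSet n))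

/-- Holevo χ-quantity of a finite ensemble. -/
def finChi {d m : ℕ} (π : Fin m → ℝ) (σ : Fin m → Matrix (Fin d) (Fin d) ℂ) : ℝ :=
  vnEntropy (∑ i, π i • σ i) - ∑ i, π i * vnEntropy (σ i)

/-- The set of pure states (rank-one projections) viewed inside the state space. -/
def pureStates (n : ℕ) : Set (stateSet n) := {ρ | ρ.1 * ρ.1 = ρ.1}

end

section helpers
open scoped Topology

/-- Diagonal entropy of `ρ` in the basis given by the columns of `U`. -/
noncomputable def diagEnt {ι : Type*} [Fintype ι] (U ρ : Matrix ι ι ℂ) : ℝ :=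
  ∑ i, Real.negMulLog ((star U * ρ * U) i i).re

lemma unitary_row_sum {ι : Type*} [Fintype ι] [DecidableEq ι] {P : Matrix ι ι ℂ}
    (h : P * star P = 1) (i : ι) : ∑ k, Complex.normSq (P i k) = 1 := by
  have := congrArg (fun M => (M i i).re) h
  simpa [Matrix.mul_apply, Matrix.star_apply, Complex.mul_conj] using this

lemma unitary_col_sum {ι : Type*} [Fintype ι] [DecidableEq ι] {P : Matrix ι ι ℂ}
    (h : star P * P = 1) (k : ι) : ∑ i, Complex.normSq (P i k) = 1 := by
  have := congrArg (fun M => (M k k).re) h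
  simpa [Matrix.mul_apply, Matrix.star_apply, Complex.normSq_apply] using this

lemma vnEntropy_of_herm {ι : Type*} [Fintype ι] [DecidableEq ι] {ρ : Matrix ι ι ℂ}
    (h : ρ.IsHermitian) : vnEntropy ρ = ∑ i, Real.negMulLog (h.eigenvalues i) := by
  simp [vnEntropy, h]

lemma diagEnt_eigen {ι : Type*} [Fintype ι] [DecidableEq ι] {ρ : Matrix ι ι ℂ}
    (h : ρ.IsHermitian) :
    diagEnt (h.eigenvectorUnitary : Matrix ι ι ℂ) ρ = vnEntropy ρ := by
  have h1 := h.conjStarAlgAut_star_eigenvectorUnitary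
  rw [Unitary.conjStarAlgAut_star_apply] at h1
  rw [vnEntropy_of_herm h, diagEnt]
  refine Finset.sum_congr rfl fun i _ => ?_
  rw [h1]
  simp

lemma vnEntropy_le_diagEnt {ι : Type*} [Fintype ι] [DecidableEq ι] {ρ U : Matrix ι ι ℂ}
    (hρ : ρ.PosSemidef) (hU : U ∈ Matrix.unitaryGroup ι ℂ) :
    vnEntropy ρ ≤ diagEnt U ρ := by
  have h := hρ.1
  set W : Matrix ι ι ℂ := (h.eigenvectorUnitary : Matrix ι ι ℂ) with hW
  have hW1 : W * star W = 1 := Matrix.mem_unitaryGroup_iff.1 h.eigenvectorUnitary.2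
  have hW2 : star W * W = 1 := Matrix.mem_unitaryGroup_iff'.1 h.eigenvectorUnitary.2
  have hU1 : U * star U = 1 := Matrix.mem_unitaryGroup_iff.1 hU
  have hU2 : star U * U = 1 := Matrix.mem_unitaryGroup_iff'.1 hU
  set P := star U * W with hP
  have hP1 : P * star P = 1 := by
    rw [hP, star_mul, star_star]
    calc star U * W * (star W * U) = star U * (W * star W) * U := by noncomm_ring
      _ = 1 := by rw [hW1, mul_one, hU2]
  have hP2 : star P * P = 1 := by
    rw [hP, star_mul, star_star]
    calc star W * U * (star U * W) = star W * (U * star U) * W := by noncomm_ring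
      _ = 1 := by rw [hU1, mul_one, hW2]
  have hsp : ρ = W * diagonal (RCLike.ofReal ∘ h.eigenvalues) * star W := by
    have := h.spectral_theorem
    rw [Unitary.conjStarAlgAut_apply] at this
    exact this
  have hent : ∀ i, ((star U * ρ * U) i i).re
      = ∑ k, Complex.normSq (P i k) * h.eigenvalues k := by
    intro i
    have : star U * ρ * U = P * diagonal (RCLike.ofReal ∘ h.eigenvalues) * star P := by
      conv_lhs => rw [hsp]
      rw [hP, star_mul, star_star]; noncomm_ring
    rw [this, Matrix.mul_apply, Complex.re_sum]
    refine Finset.sum_congr rfl fun k _ => ?_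
    simp [Matrix.mul_diagonal, Matrix.star_apply, Complex.normSq_apply]
    ring
  rw [vnEntropy_of_herm h, diagEnt]
  calc ∑ k, Real.negMulLog (h.eigenvalues k)
      = ∑ k, (∑ i, Complex.normSq (P i k)) * Real.negMulLog (h.eigenvalues k) := by
        simp [unitary_col_sum hP2]
    _ = ∑ i, ∑ k, Complex.normSq (P i k) * Real.negMulLog (h.eigenvalues k) := by
        simp_rw [Finset.sum_mul]; rw [Finset.sum_comm]
    _ ≤ _ := by
        refine Finset.sum_le_sum fun i _ => ?_
        rw [hent]
        exact Real.concaveOn_negMulLog.le_map_sum (fun k _ => Complex.normSq_nonneg _)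
          (unitary_row_sum hP1 i) (fun k _ => hρ.eigenvalues_nonneg k)

lemma posSemidef_conj_diag_nonneg {ι : Type*} [Fintype ι] [DecidableEq ι] {ρ : Matrix ι ι ℂ}
    (hρ : ρ.PosSemidef) (U : Matrix ι ι ℂ) (i : ι) : 0 ≤ ((star U * ρ * U) i i).re := by
  have := (hρ.conjTranspose_mul_mul_same U).diag_nonneg (i := i)
  exact (Complex.le_def.1 this).1

/-- Concavity of the von Neumann entropy. -/
lemma vnEntropy_concave {ι : Type*} [Fintype ι] [DecidableEq ι] :
    ConcaveOn ℝ {ρ : Matrix ι ι ℂ | ρ.PosSemidef} vnEntropy := by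
  have hc : Convex ℝ {ρ : Matrix ι ι ℂ | ρ.PosSemidef} := by
    intro x hx y hy a b ha hb _
    exact (Matrix.PosSemidef.smul hx ha).add (Matrix.PosSemidef.smul hy hb)
  refine ⟨hc, fun x hx y hy a b ha hb hab => ?_⟩
  have hz := hc hx hy ha hb hab
  have hz' : (a • x + b • y).PosSemidef := hz
  rw [← diagEnt_eigen hz'.1]
  set U := hz'.1.eigenvectorUnitary
  have h1 := vnEntropy_le_diagEnt hx U.2
  have h2 := vnEntropy_le_diagEnt hy U.2
  refine (add_le_add (smul_le_smul_of_nonneg_left h1 ha) (smul_le_smul_of_nonneg_left h2 hb)).trans ?_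
  simp only [diagEnt, Finset.smul_sum, ← Finset.sum_add_distrib]
  refine Finset.sum_le_sum fun i _ => ?_
  refine (Real.concaveOn_negMulLog.2 (posSemidef_conj_diag_nonneg hx _ i)
    (posSemidef_conj_diag_nonneg hy _ i) ha hb hab).trans (le_of_eq ?_)
  congr 1
  simp [mul_add, add_mul]

lemma isCompact_unitary {ι : Type*} [Fintype ι] [DecidableEq ι] :
    IsCompact {U : Matrix ι ι ℂ | U ∈ Matrix.unitaryGroup ι ℂ} := by
  have hK : IsCompact (Set.univ.pi fun _ : ι => Set.univ.pi fun _ : ι => Metric.closedBall (0:ℂ) 1) :=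
    isCompact_univ_pi fun _ => isCompact_univ_pi fun _ => isCompact_closedBall _ _
  refine hK.of_isClosed_subset ?_ ?_
  · simp only [Matrix.mem_unitaryGroup_iff]
    exact isClosed_eq (by fun_prop) continuous_const
  · intro U hU i _ j _
    simpa using entry_norm_bound_of_unitary hU i j

lemma vnEntropy_eq_sInf {ι : Type*} [Fintype ι] [DecidableEq ι] {ρ : Matrix ι ι ℂ}
    (hρ : ρ.PosSemidef) :
    vnEntropy ρ = sInf ((fun U => diagEnt U ρ) '' {U : Matrix ι ι ℂ | U ∈ Matrix.unitaryGroup ι ℂ}) := by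
  symm
  apply IsLeast.csInf_eq
  refine ⟨⟨_, hρ.1.eigenvectorUnitary.2, diagEnt_eigen hρ.1⟩, ?_⟩
  rintro _ ⟨U, hU, rfl⟩
  exact vnEntropy_le_diagEnt hρ hU

lemma vnEntropy_continuousOn {ι : Type*} [Fintype ι] [DecidableEq ι] :
    ContinuousOn (vnEntropy (ι := ι)) {ρ : Matrix ι ι ℂ | ρ.PosSemidef} := by
  have hc : Continuous fun ρ : Matrix ι ι ℂ =>
      sInf ((fun U => diagEnt U ρ) '' {U : Matrix ι ι ℂ | U ∈ Matrix.unitaryGroup ι ℂ}) := by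
    refine IsCompact.continuous_sInf (f := fun ρ U : Matrix ι ι ℂ => diagEnt U ρ) isCompact_unitary ?_
    unfold diagEnt
    refine continuous_finsetSum _ fun i _ => Real.continuous_negMulLog.comp
      (Complex.continuous_re.comp ?_)
    have : Continuous fun p : Matrix ι ι ℂ × Matrix ι ι ℂ => star p.2 * p.1 * p.2 := by fun_prop
    exact this.matrix_elem i i
  exact hc.continuousOn.congr fun ρ hρ => vnEntropy_eq_sInf hρ

section sq
open scoped MatrixOrder Matrix.Norms.L2Operator

/-- Matrix square root. -/
noncomputable def msqrt {n : ℕ} (ρ : Matrix (Fin n) (Fin n) ℂ) : Matrix (Fin n) (Fin n) ℂ :=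
  CFC.sqrt ρ

lemma msqrt_herm {n : ℕ} {ρ : Matrix (Fin n) (Fin n) ℂ} (_h : ρ.PosSemidef) :
    (msqrt ρ)ᴴ = msqrt ρ :=
  (Matrix.nonneg_iff_posSemidef.1 (CFC.sqrt_nonneg ρ)).1

lemma msqrt_mul {n : ℕ} {ρ : Matrix (Fin n) (Fin n) ℂ} (h : ρ.PosSemidef) :
    msqrt ρ * msqrt ρ = ρ :=
  CFC.sqrt_mul_sqrt_self ρ (Matrix.nonneg_iff_posSemidef.2 h)

lemma msqrt_cont' {n : ℕ} : ContinuousOn (msqrt (n := n)) {ρ | ρ.PosSemidef} := by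
  have := CFC.continuousOn_sqrt (A := Matrix (Fin n) (Fin n) ℂ)
  simp only [Matrix.nonneg_iff_posSemidef] at this
  exact this

end sq

lemma msqrt_continuous {n : ℕ} : Continuous fun ρ : stateSet n => msqrt ρ.1 :=
  msqrt_cont'.comp_continuous continuous_subtype_val fun ρ => ρ.2.1

lemma isCompact_stateSet (n : ℕ) : IsCompact (stateSet n) := by
  have hK : IsCompact (Set.univ.pi fun _ : Fin n => Set.univ.pi fun _ : Fin n =>
      Metric.closedBall (0:ℂ) 1) :=
    isCompact_univ_pi fun _ => isCompact_univ_pi fun _ => isCompact_closedBall _ _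
  have hT : IsCompact {B : Matrix (Fin n) (Fin n) ℂ | (Bᴴ * B).trace = 1} := by
    refine hK.of_isClosed_subset (isClosed_eq (by fun_prop) continuous_const) ?_
    intro (B : Matrix (Fin n) (Fin n) ℂ) hB i _ j _
    have h1 : ∑ k, ∑ l, Complex.normSq (B l k) = 1 := by
      have := congrArg Complex.re hB
      simp only [Matrix.trace, Matrix.diag_apply, Complex.re_sum] at this
      have e : ∀ k, (Bᴴ * B) k k = ∑ l, star (B l k) * B l k := fun k => Matrix.mul_apply
      simp only [e] at this
      simpa [Complex.normSq_apply] using this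
    have h2 : Complex.normSq (B i j) ≤ 1 := by
      rw [← h1]
      refine (Finset.single_le_sum (f := fun l => Complex.normSq (B l j))
        (fun _ _ => Complex.normSq_nonneg _) (Finset.mem_univ i)).trans ?_
      exact Finset.single_le_sum (f := fun k => ∑ l, Complex.normSq (B l k))
        (fun _ _ => Finset.sum_nonneg fun _ _ => Complex.normSq_nonneg _) (Finset.mem_univ j)
    rw [Complex.normSq_eq_norm_sq] at h2
    simp only [mem_closedBall_zero_iff]
    nlinarith [norm_nonneg (B i j)]
  have : stateSet n = (fun B : Matrix (Fin n) (Fin n) ℂ => Bᴴ * B) ''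
      {B : Matrix (Fin n) (Fin n) ℂ | (Bᴴ * B).trace = 1} := by
    ext ρ
    constructor
    · rintro ⟨h1, h2⟩
      have h3 : (msqrt ρ)ᴴ * msqrt ρ = ρ := by rw [msqrt_herm h1, msqrt_mul h1]
      exact ⟨msqrt ρ, by simpa [h3] using h2, h3⟩
    · rintro ⟨B, hB, rfl⟩
      exact ⟨Matrix.posSemidef_conjTranspose_mul_self B, hB⟩
  rw [this]
  exact hT.image (by fun_prop)

instance stateSet_compactSpace (n : ℕ) : CompactSpace (stateSet n) :=
  isCompact_iff_compactSpace.1 (isCompact_stateSet n)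

instance matrix_t2 (n : ℕ) : T2Space (Matrix (Fin n) (Fin n) ℂ) :=
  inferInstanceAs (T2Space (Fin n → Fin n → ℂ))

instance stateSet_second (n : ℕ) : SecondCountableTopology (Matrix (Fin n) (Fin n) ℂ) :=
  inferInstanceAs (SecondCountableTopology (Fin n → Fin n → ℂ))

lemma chanPhi_add {dA dB dE : ℕ} (V : Matrix (Fin dB × Fin dE) (Fin dA) ℂ)
    (x y : Matrix (Fin dA) (Fin dA) ℂ) : chanPhi V (x + y) = chanPhi V x + chanPhi V y := by
  ext i j
  simp [chanPhi, ptraceE, Matrix.mul_add, Matrix.add_mul, Finset.sum_add_distrib]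

lemma chanPhi_smul {dA dB dE : ℕ} (V : Matrix (Fin dB × Fin dE) (Fin dA) ℂ) (c : ℝ)
    (x : Matrix (Fin dA) (Fin dA) ℂ) : chanPhi V (c • x) = c • chanPhi V x := by
  ext i j
  simp [chanPhi, ptraceE, Finset.mul_sum]

lemma chanPhi_continuous {dA dB dE : ℕ} (V : Matrix (Fin dB × Fin dE) (Fin dA) ℂ) :
    Continuous (chanPhi V) := by
  have h : Continuous fun ρ : Matrix (Fin dA) (Fin dA) ℂ => V * ρ * Vᴴ := by fun_prop
  refine continuous_matrix fun i j => ?_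
  simp only [chanPhi, ptraceE, Matrix.of_apply]
  exact continuous_finsetSum _ fun e _ => h.matrix_elem _ _

lemma chanPhi_psd {dA dB dE : ℕ} (V : Matrix (Fin dB × Fin dE) (Fin dA) ℂ)
    {ρ : Matrix (Fin dA) (Fin dA) ℂ} (h : ρ.PosSemidef) : (chanPhi V ρ).PosSemidef := by
  have h1 := h.mul_mul_conjTranspose_same V
  have h2 : chanPhi V ρ = ∑ e : Fin dE,
      (V * ρ * Vᴴ).submatrix (fun b : Fin dB => (b, e)) (fun b : Fin dB => (b, e)) := by
    ext i j
    simp [chanPhi, ptraceE, Matrix.sum_apply]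
  rw [h2]
  exact Matrix.posSemidef_sum _ fun e _ => h1.submatrix _

/-- Output entropy. -/
noncomputable def outEnt {dA dB dE : ℕ} (V : Matrix (Fin dB × Fin dE) (Fin dA) ℂ)
    (ρ : Matrix (Fin dA) (Fin dA) ℂ) : ℝ := vnEntropy (chanPhi V ρ)

lemma outEnt_concave {dA dB dE : ℕ} (V : Matrix (Fin dB × Fin dE) (Fin dA) ℂ) :
    ConcaveOn ℝ {ρ : Matrix (Fin dA) (Fin dA) ℂ | ρ.PosSemidef} (outEnt V) := by
  refine ⟨vnEntropy_concave.1, fun x hx y hy a b ha hb hab => ?_⟩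
  have := vnEntropy_concave.2 (chanPhi_psd V hx) (chanPhi_psd V hy) ha hb hab
  simpa only [outEnt, chanPhi_add, chanPhi_smul] using this

lemma outEnt_continuousOn {dA dB dE : ℕ} (V : Matrix (Fin dB × Fin dE) (Fin dA) ℂ) :
    ContinuousOn (outEnt V) {ρ : Matrix (Fin dA) (Fin dA) ℂ | ρ.PosSemidef} :=
  vnEntropy_continuousOn.comp (chanPhi_continuous V).continuousOn fun _ h => chanPhi_psd V h

lemma outEnt_continuous {dA dB dE : ℕ} (V : Matrix (Fin dB × Fin dE) (Fin dA) ℂ) :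
    Continuous fun ρ : stateSet dA => outEnt V ρ.1 :=
  (outEnt_continuousOn V).comp_continuous continuous_subtype_val fun ρ => ρ.2.1

lemma entry_continuous {n : ℕ} (i j : Fin n) : Continuous fun ρ : stateSet n => ρ.1 i j :=
  continuous_subtype_val.matrix_elem i j

lemma integrable_of_cont {n : ℕ} {E : Type*} [NormedAddCommGroup E] [SecondCountableTopology E]
    [MeasurableSpace E] [BorelSpace E]
    {f : stateSet n → E} (hf : Continuous f)
    (μ : Measure (stateSet n)) [IsFiniteMeasure μ] : Integrable f μ := by
  obtain ⟨C, hC⟩ := isCompact_univ.exists_bound_of_continuousOn hf.continuousOn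
  exact Integrable.of_bound hf.measurable.aestronglyMeasurable C
    (Filter.Eventually.of_forall fun x => hC x (Set.mem_univ x))

lemma barycenter_psd {n : ℕ} (μ : ProbabilityMeasure (stateSet n)) :
    (barycenter μ).PosSemidef := by
  refine Matrix.PosSemidef.of_dotProduct_mulVec_nonneg ?_ ?_
  · ext i j
    simp only [barycenter, Matrix.conjTranspose_apply, Matrix.of_apply, Complex.star_def]
    rw [← integral_conj]
    refine integral_congr_ae (Filter.Eventually.of_forall fun ρ => ?_)
    exact congrFun (congrFun ρ.2.1.1 i) j
  · intro x
    have h : star x ⬝ᵥ (barycenter μ *ᵥ x)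
        = ∫ ρ : stateSet n, star x ⬝ᵥ (ρ.1 *ᵥ x) ∂(μ : Measure (stateSet n)) := by
      simp only [dotProduct, mulVec, barycenter, Matrix.of_apply]
      rw [integral_finsetSum]
      · refine Finset.sum_congr rfl fun i _ => ?_
        rw [integral_const_mul, integral_finsetSum]
        · simp_rw [integral_mul_const]
        · exact fun j _ => (integrable_of_cont (entry_continuous i j) _).mul_const _
      · exact fun i _ => (integrable_finsetSum _ fun j _ =>
          (integrable_of_cont (entry_continuous i j) _).mul_const _).const_mul _
    rw [h]
    exact integral_nonneg fun ρ => ρ.2.1.dotProduct_mulVec_nonneg x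

lemma continuous_integral {n : ℕ} {𝕜 : Type*} [RCLike 𝕜] {f : stateSet n → 𝕜}
    (hf : Continuous f) :
    Continuous fun μ : ProbabilityMeasure (stateSet n) => ∫ ρ, f ρ ∂(μ : Measure (stateSet n)) := by
  refine continuous_iff_continuousAt.2 fun μ => ?_
  exact (ProbabilityMeasure.tendsto_iff_forall_integral_rclike_tendsto 𝕜).1 Filter.tendsto_id
    (BoundedContinuousFunction.mkOfCompact ⟨f, hf⟩)

lemma barycenter_continuous (n : ℕ) :
    Continuous (barycenter : ProbabilityMeasure (stateSet n) → _) :=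
  continuous_matrix fun i j => continuous_integral (entry_continuous i j)

lemma gChiOut_continuous {dA dB dE : ℕ} (V : Matrix (Fin dB × Fin dE) (Fin dA) ℂ) :
    Continuous (gChiOut (chanPhi V)) :=
  ((outEnt_continuousOn V).comp_continuous (barycenter_continuous dA) barycenter_psd).sub
    (continuous_integral (outEnt_continuous V))

/-- The unnormalized pure component `√ρ |i⟩⟨i| √ρ`. -/
noncomputable def sqrtComp {n : ℕ} (i : Fin n) (ρ : Matrix (Fin n) (Fin n) ℂ) :
    Matrix (Fin n) (Fin n) ℂ := msqrt ρ * Matrix.single i i 1 * msqrt ρ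

lemma sqrtComp_apply {n : ℕ} (i : Fin n) (ρ : Matrix (Fin n) (Fin n) ℂ) (a b : Fin n) :
    sqrtComp i ρ a b = msqrt ρ a i * msqrt ρ i b := by
  simp [sqrtComp, Matrix.mul_apply, Matrix.single_apply, ite_and]

lemma sqrtComp_psd {n : ℕ} (i : Fin n) {ρ : Matrix (Fin n) (Fin n) ℂ} (h : ρ.PosSemidef) :
    (sqrtComp i ρ).PosSemidef := by
  have h1 : (Matrix.single i i (1:ℂ)).PosSemidef := by
    rw [← Matrix.diagonal_single]
    refine Matrix.PosSemidef.diagonal ?_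
    intro j
    by_cases hj : j = i <;> simp [hj]
  have := h1.mul_mul_conjTranspose_same (msqrt ρ)
  rwa [msqrt_herm h] at this

lemma sqrtComp_sum {n : ℕ} {ρ : Matrix (Fin n) (Fin n) ℂ} (h : ρ.PosSemidef) :
    ∑ i, sqrtComp i ρ = ρ := by
  ext a b
  rw [Matrix.sum_apply]
  conv_rhs => rw [← msqrt_mul h, Matrix.mul_apply]
  simp_rw [sqrtComp_apply]

lemma diag_re {n : ℕ} {ρ : Matrix (Fin n) (Fin n) ℂ} (h : ρ.PosSemidef) (i : Fin n) :
    (((ρ i i).re : ℝ) : ℂ) = ρ i i := by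
  have := h.1.apply i i
  exact Complex.conj_eq_iff_re.1 this

lemma diag_re_nonneg {n : ℕ} {ρ : Matrix (Fin n) (Fin n) ℂ} (h : ρ.PosSemidef) (i : Fin n) :
    0 ≤ (ρ i i).re := (Complex.le_def.1 (h.diag_nonneg (i := i))).1

lemma sqrtComp_trace {n : ℕ} {ρ : Matrix (Fin n) (Fin n) ℂ} (h : ρ.PosSemidef) (i : Fin n) :
    (sqrtComp i ρ).trace = ((ρ i i).re : ℝ) := by
  rw [diag_re h]
  conv_rhs => rw [← msqrt_mul h, Matrix.mul_apply]
  simp only [Matrix.trace, Matrix.diag_apply, sqrtComp_apply]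
  exact Finset.sum_congr rfl fun k _ => mul_comm _ _

lemma sqrtComp_mul {n : ℕ} {ρ : Matrix (Fin n) (Fin n) ℂ} (h : ρ.PosSemidef) (i : Fin n) :
    sqrtComp i ρ * sqrtComp i ρ = (ρ i i).re • sqrtComp i ρ := by
  ext a b
  have h1 : ρ i i = ∑ k, msqrt ρ i k * msqrt ρ k i := by
    conv_lhs => rw [← msqrt_mul h, Matrix.mul_apply]
  simp only [Matrix.mul_apply, Matrix.smul_apply, sqrtComp_apply, Complex.real_smul]
  rw [diag_re h, h1, Finset.sum_mul]
  exact Finset.sum_congr rfl fun k _ => by ring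

/-- The normalized pure component. -/
noncomputable def pureComp {n : ℕ} (i : Fin n) (ρ : stateSet n) : Matrix (Fin n) (Fin n) ℂ :=
  if (ρ.1 i i).re = 0 then Matrix.single i i 1 else (ρ.1 i i).re⁻¹ • sqrtComp i ρ.1

lemma single_psd {n : ℕ} (i : Fin n) : (Matrix.single i i (1:ℂ)).PosSemidef := by
  rw [← Matrix.diagonal_single]
  refine Matrix.PosSemidef.diagonal ?_
  intro j
  by_cases hj : j = i <;> simp [hj]

lemma pureComp_mem {n : ℕ} (i : Fin n) (ρ : stateSet n) : pureComp i ρ ∈ stateSet n := by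
  unfold pureComp
  split_ifs with h
  · exact ⟨single_psd i, by simp⟩
  · refine ⟨(sqrtComp_psd i ρ.2.1).smul (inv_nonneg.2 (diag_re_nonneg ρ.2.1 i)), ?_⟩
    rw [Matrix.trace_smul, sqrtComp_trace ρ.2.1, Complex.real_smul, ← Complex.ofReal_mul,
      inv_mul_cancel₀ h, Complex.ofReal_one]

lemma pureComp_sq {n : ℕ} (i : Fin n) (ρ : stateSet n) :
    pureComp i ρ * pureComp i ρ = pureComp i ρ := by
  unfold pureComp
  split_ifs with h
  · simp
  · rw [Matrix.smul_mul, Matrix.mul_smul, sqrtComp_mul ρ.2.1, inv_smul_smul₀ h]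

lemma smul_pureComp {n : ℕ} (i : Fin n) (ρ : stateSet n) :
    (ρ.1 i i).re • pureComp i ρ = sqrtComp i ρ.1 := by
  unfold pureComp
  split_ifs with h
  · have h1 : (sqrtComp i ρ.1) = 0 := by
      rw [← (sqrtComp_psd i ρ.2.1).trace_eq_zero_iff, sqrtComp_trace ρ.2.1, h, Complex.ofReal_zero]
    rw [h1, h, zero_smul]
  · rw [smul_inv_smul₀ h]

/-- The pure component as a map on states. -/
noncomputable def pc {n : ℕ} (i : Fin n) (ρ : stateSet n) : stateSet n :=
  ⟨pureComp i ρ, pureComp_mem i ρ⟩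

lemma sqrtComp_continuous {n : ℕ} (i : Fin n) : Continuous fun ρ : stateSet n => sqrtComp i ρ.1 := by
  unfold sqrtComp
  have := msqrt_continuous (n := n)
  fun_prop

lemma re_continuous {n : ℕ} (i : Fin n) : Continuous fun ρ : stateSet n => (ρ.1 i i).re :=
  Complex.continuous_re.comp (entry_continuous i i)

lemma pc_measurable {n : ℕ} (i : Fin n) : Measurable (pc i : stateSet n → stateSet n) := by
  refine Measurable.subtype_mk ?_
  unfold pureComp
  refine Measurable.ite ?_ measurable_const ?_
  · exact (re_continuous i).measurable (measurableSet_singleton 0)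
  · refine measurable_pi_iff.2 fun a => measurable_pi_iff.2 fun b => ?_
    exact (re_continuous i).measurable.inv.smul ((sqrtComp_continuous i).matrix_elem a b).measurable

/-- The purified ensemble. -/
noncomputable def purify {n : ℕ} (μ : Measure (stateSet n)) : Measure (stateSet n) :=
  ∑ i : Fin n, Measure.map (pc i) (μ.withDensity fun ρ => ENNReal.ofReal (ρ.1 i i).re)

lemma purify_univ {n : ℕ} (μ : Measure (stateSet n)) [IsProbabilityMeasure μ] :
    purify μ Set.univ = 1 := by
  simp only [purify, Measure.coe_finsetSum, Finset.sum_apply]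
  have : ∀ i : Fin n, Measure.map (pc i) (μ.withDensity fun ρ => ENNReal.ofReal (ρ.1 i i).re)
      Set.univ = ∫⁻ ρ, ENNReal.ofReal (ρ.1 i i).re ∂μ := by
    intro i
    rw [Measure.map_apply (pc_measurable i) MeasurableSet.univ, Set.preimage_univ,
      withDensity_apply _ MeasurableSet.univ, Measure.restrict_univ]
  simp_rw [this]
  rw [← lintegral_finsetSum _ fun i _ => (re_continuous i).measurable.ennreal_ofReal]
  have h2 : ∀ ρ : stateSet n, ∑ i, ENNReal.ofReal (ρ.1 i i).re = 1 := by
    intro ρ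
    rw [← ENNReal.ofReal_sum_of_nonneg fun i _ => diag_re_nonneg ρ.2.1 i, ← Complex.re_sum]
    have : ∑ i, ρ.1 i i = 1 := ρ.2.2
    simp [this]
  simp [h2]

instance purify_prob {n : ℕ} (μ : Measure (stateSet n)) [IsProbabilityMeasure μ] :
    IsProbabilityMeasure (purify μ) := ⟨purify_univ μ⟩

lemma pureStates_measurable (n : ℕ) : MeasurableSet (pureStates n) := by
  have : IsClosed (pureStates n) :=
    isClosed_eq (by fun_prop) (by fun_prop)
  exact this.measurableSet

lemma purify_pure {n : ℕ} (μ : Measure (stateSet n)) [IsProbabilityMeasure μ] :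
    purify μ (pureStates n) = 1 := by
  rw [← purify_univ μ]
  simp only [purify, Measure.coe_finsetSum, Finset.sum_apply]
  refine Finset.sum_congr rfl fun i _ => ?_
  rw [Measure.map_apply (pc_measurable i) (pureStates_measurable n),
    Measure.map_apply (pc_measurable i) MeasurableSet.univ]
  congr 1
  ext ρ
  simpa using! pureComp_sq i ρ

lemma purify_piece_le {n : ℕ} (μ : Measure (stateSet n)) (i : Fin n) :
    Measure.map (pc i) (μ.withDensity fun ρ => ENNReal.ofReal (ρ.1 i i).re) ≤ purify μ := by
  rw [Measure.le_iff]
  intro s _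
  simp only [purify, Measure.coe_finsetSum, Finset.sum_apply]
  exact Finset.single_le_sum (f := fun i : Fin n => Measure.map (pc i)
    (μ.withDensity fun ρ => ENNReal.ofReal (ρ.1 i i).re) s) (fun _ _ => zero_le)
    (Finset.mem_univ i)

lemma integrable_piece {n : ℕ} {E : Type*} [NormedAddCommGroup E] [NormedSpace ℝ E]
    [SecondCountableTopology E] [MeasurableSpace E] [BorelSpace E]
    {f : stateSet n → E} (hf : Continuous f)
    (μ : Measure (stateSet n)) [IsProbabilityMeasure μ] (i : Fin n) :
    Integrable (fun ρ => (ρ.1 i i).re • f (pc i ρ)) μ := by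
  obtain ⟨C, hC⟩ := isCompact_univ.exists_bound_of_continuousOn hf.continuousOn
  have h1 : Integrable (fun ρ => f (pc i ρ)) μ :=
    Integrable.of_bound (hf.measurable.comp (pc_measurable i)).aestronglyMeasurable C
      (Filter.Eventually.of_forall fun x => hC _ (Set.mem_univ _))
  obtain ⟨D, hD⟩ := isCompact_univ.exists_bound_of_continuousOn (re_continuous i).continuousOn
  exact h1.bdd_smul D (re_continuous i).measurable.aestronglyMeasurable
    (Filter.Eventually.of_forall fun x => hD _ (Set.mem_univ _))

lemma purify_integral {n : ℕ} {E : Type*} [NormedAddCommGroup E] [NormedSpace ℝ E]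
    [SecondCountableTopology E] [MeasurableSpace E] [BorelSpace E] [CompleteSpace E]
    {f : stateSet n → E} (hf : Continuous f)
    (μ : Measure (stateSet n)) [IsProbabilityMeasure μ] :
    ∫ ρ, f ρ ∂(purify μ) = ∫ ρ, ∑ i, (ρ.1 i i).re • f (pc i ρ) ∂μ := by
  rw [integral_finsetSum _ fun i _ => integrable_piece hf μ i, purify,
    integral_finsetSum_measure]
  · refine Finset.sum_congr rfl fun i _ => ?_
    rw [integral_map (pc_measurable i).aemeasurable hf.measurable.aestronglyMeasurable,
      integral_withDensity_eq_integral_toReal_smul (re_continuous i).measurable.ennreal_ofReal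
        (Filter.Eventually.of_forall fun _ => ENNReal.ofReal_lt_top)]
    refine integral_congr_ae (Filter.Eventually.of_forall fun ρ => ?_)
    simp only [ENNReal.toReal_ofReal (diag_re_nonneg ρ.2.1 i)]
  · exact fun i _ => (integrable_of_cont hf (purify μ)).mono_measure (purify_piece_le μ i)

lemma purify_barycenter {n : ℕ} (μ : ProbabilityMeasure (stateSet n)) :
    barycenter (⟨purify μ, purify_prob _⟩ : ProbabilityMeasure (stateSet n)) = barycenter μ := by
  ext a b
  simp only [barycenter, Matrix.of_apply, ProbabilityMeasure.coe_mk]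
  rw [purify_integral (entry_continuous a b)]
  refine integral_congr_ae (Filter.Eventually.of_forall fun ρ => ?_)
  have h : ∀ i, (ρ.1 i i).re • (pc i ρ).1 a b = sqrtComp i ρ.1 a b := fun i => by
    rw [← smul_pureComp]; rfl
  simp only [h]
  rw [← Matrix.sum_apply, sqrtComp_sum ρ.2.1]

lemma purify_chi {dA dB dE : ℕ} (V : Matrix (Fin dB × Fin dE) (Fin dA) ℂ)
    (μ : ProbabilityMeasure (stateSet dA)) :
    gChiOut (chanPhi V) μ ≤
      gChiOut (chanPhi V) (⟨purify μ, purify_prob _⟩ : ProbabilityMeasure (stateSet dA)) := by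
  unfold gChiOut
  rw [purify_barycenter]
  refine sub_le_sub_left ?_ _
  have key := purify_integral (outEnt_continuous V) (μ : Measure (stateSet dA))
  refine (le_of_eq key).trans ?_
  refine integral_mono (integrable_finsetSum _ fun i _ => integrable_piece (outEnt_continuous V) _ i)
    (integrable_of_cont (outEnt_continuous V) _) fun ρ => ?_
  have hs : ∑ i, (ρ.1 i i).re = 1 := by
    rw [← Complex.re_sum]
    have : ∑ i, ρ.1 i i = 1 := ρ.2.2
    simp [this]
  have := (outEnt_concave V).le_map_sum (t := Finset.univ) (w := fun i => (ρ.1 i i).re)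
    (p := fun i => (pc i ρ).1) (fun i _ => diag_re_nonneg ρ.2.1 i) hs (fun i _ => (pc i ρ).2.1)
  refine this.trans (le_of_eq ?_)
  congr 1
  rw [← sqrtComp_sum ρ.2.1]
  exact Finset.sum_congr rfl fun i _ => by rw [sqrtComp_sum ρ.2.1]; exact smul_pureComp i ρ

lemma barycenter_dirac {n : ℕ} (ρ : stateSet n) :
    barycenter (⟨Measure.dirac ρ, inferInstance⟩ : ProbabilityMeasure (stateSet n)) = ρ.1 := by
  ext a b
  simp [barycenter, integral_dirac]

end helpers

/-- Existence of a χ-optimal ensemble supported by pure states under the energy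
constraint `Re (Tr (H_A ρ̄(μ))) ≤ 𝓔`, provided the constraint is satisfiable. -/
theorem exists_chi_optimal_pure_ensemble_energy_constraint
    (dA dB dE : ℕ) (hdA : 0 < dA) (hdB : 0 < dB) (hdE : 0 < dE)
    (V : Matrix (Fin dB × Fin dE) (Fin dA) ℂ) (hV : Vᴴ * V = 1)
    (HA : Matrix (Fin dA) (Fin dA) ℂ) (hHA : HA.PosSemidef)
    (𝓔 : ℝ) (hNe : ∃ ρ₀ : stateSet dA, ((HA * ρ₀.1).trace).re ≤ 𝓔) :
    ∃ μs : ProbabilityMeasure (stateSet dA),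
      (μs : Measure (stateSet dA)) (pureStates dA) = 1 ∧
      ((HA * barycenter μs).trace).re ≤ 𝓔 ∧
      gChiOut (chanPhi V) μs
        = sSup {x : ℝ | ∃ μ : ProbabilityMeasure (stateSet dA),
            ((HA * barycenter μ).trace).re ≤ 𝓔 ∧ gChiOut (chanPhi V) μ = x} := by
  have hcl : IsClosed {μ : ProbabilityMeasure (stateSet dA) |
      ((HA * barycenter μ).trace).re ≤ 𝓔} := by
    have := barycenter_continuous dA
    exact isClosed_le (by fun_prop) continuous_const
  obtain ⟨ρ₀, h₀⟩ := hNe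
  have hne : ((HA * barycenter (⟨Measure.dirac ρ₀, inferInstance⟩ :
      ProbabilityMeasure (stateSet dA))).trace).re ≤ 𝓔 := by
    rw [barycenter_dirac]; exact h₀
  obtain ⟨μ, hμ, hmax⟩ := hcl.isCompact.exists_isMaxOn
    ⟨_, hne⟩
    (gChiOut_continuous V).continuousOn
  have hfeas : ((HA * barycenter (⟨purify μ, purify_prob _⟩ :
      ProbabilityMeasure (stateSet dA))).trace).re ≤ 𝓔 := by
    rw [purify_barycenter]; exact hμ
  refine ⟨⟨purify μ, purify_prob _⟩, purify_pure _, hfeas, ?_⟩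
  symm
  apply IsGreatest.csSup_eq
  refine ⟨⟨_, hfeas, rfl⟩, ?_⟩
  rintro _ ⟨ν, hν, rfl⟩
  exact (hmax hν).trans (purify_chi V μ)
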